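/- arXiv:2205.04107 — 5 statements merged into one kernel-verified Lean document; each statement's English description precedes it below -/
import Mathlib

section
/- Let μ > 0, β > 0, c ∈ ℝ and s ≤ b be real numbers, and define g : ℝ → ℝ by g(t) = μ + (c − μ)·exp(−β(t − s)). Define t* = min( s + β⁻¹·log((μ − c)/μ)·𝟙{c < 0}, b ), i.e. t* = min(s + β⁻¹·log((μ − c)/μ), b) if c < 0 and t* = s if c ≥ 0. Then ∫_s^b max(g(u), 0) du = μ·(b − t*) + β⁻¹·(c − μ)·(exp(−β(t* − s)) − exp(−β(b − s))). -/
open Real intervalIntegral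

/-- Single-interval compensator formula: with
`g t = μ + (c - μ) * exp (-β * (t - s))` and restart time
`t* = min (s + β⁻¹ * log ((μ - c) / μ) * 𝟙{c < 0}) b`, the integral of the
conditional intensity `max (g u) 0` over `[s, b]` has the closed form of
Proposition 1 of the paper. -/
theorem stmt_7 (μ β c s b : ℝ) (hμ : 0 < μ) (hβ : 0 < β) (hsb : s ≤ b)
    (g : ℝ → ℝ)
    (hg : ∀ t : ℝ, g t = μ + (c - μ) * Real.exp (-β * (t - s)))
    (tstar : ℝ)
    (htstar : tstar =
      min (s + β⁻¹ * Real.log ((μ - c) / μ) * (if c < 0 then (1 : ℝ) else 0)) b) :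
    ∫ u in s..b, max (g u) 0 =
      μ * (b - tstar) +
        β⁻¹ * (c - μ) *
          (Real.exp (-β * (tstar - s)) - Real.exp (-β * (b - s))) := by
  have hcont : Continuous g := by
    have : g = fun t => μ + (c - μ) * Real.exp (-β * (t - s)) := funext hg
    rw [this]; fun_prop
  have hmain : s ≤ tstar ∧ tstar ≤ b ∧ (∀ u, s < u → u ≤ tstar → g u ≤ 0) ∧
      (∀ u, tstar < u → u ≤ b → 0 ≤ g u) := by
    by_cases hc : c < 0
    · have hpos : 0 < (μ - c) / μ := div_pos (by linarith) hμ
      have hL : 0 ≤ Real.log ((μ - c) / μ) := by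
        apply Real.log_nonneg
        rw [le_div_iff₀ hμ]; linarith
      have hexp : (μ - c) * Real.exp (-Real.log ((μ - c) / μ)) = μ := by
        rw [Real.exp_neg, Real.exp_log hpos]
        have : μ - c ≠ 0 := by linarith
        field_simp
      simp only [hc, if_true, mul_one] at htstar
      generalize Real.log ((μ - c) / μ) = L at *
      have hbL : β * (β⁻¹ * L) = L := by field_simp
      have hbL0 : 0 ≤ β⁻¹ * L := by positivity
      generalize β⁻¹ * L = T at *
      refine ⟨?_, ?_, ?_, ?_⟩
      · rw [htstar]; exact le_min (by linarith) hsb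
      · rw [htstar]; exact min_le_right _ _
      · intro u _ hu
        have h1 : u ≤ s + T := hu.trans (htstar ▸ min_le_left _ _)
        have h2 : Real.exp (-L) ≤ Real.exp (-β * (u - s)) := by
          apply Real.exp_le_exp.mpr
          nlinarith
        rw [hg]
        nlinarith
      · intro u hu hub
        have h1 : s + T < u := by
          rw [htstar] at hu
          rcases min_lt_iff.mp hu with h | h
          · exact h
          · linarith
        have h2 : Real.exp (-β * (u - s)) ≤ Real.exp (-L) := by
          apply Real.exp_le_exp.mpr
          nlinarith
        rw [hg]
        nlinarith
    · simp only [hc, if_false, mul_zero, add_zero, min_eq_left hsb] at htstar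
      subst htstar
      refine ⟨le_rfl, hsb, fun u h1 h2 => absurd h1 (not_lt.mpr h2), ?_⟩
      intro u hu _
      rw [hg]
      have h1 : Real.exp (-β * (u - tstar)) ≤ 1 := Real.exp_le_one_iff.mpr (by nlinarith)
      have h0 := Real.exp_pos (-β * (u - tstar))
      push Not at hc
      nlinarith [mul_nonneg hc h0.le]
  obtain ⟨hst, htb, hneg, hnn⟩ := hmain
  have hc2 : Continuous fun u => max (g u) 0 := hcont.max continuous_const
  rw [← integral_add_adjacent_intervals (hc2.intervalIntegrable s tstar)
    (hc2.intervalIntegrable tstar b)]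
  have e1 : ∫ u in s..tstar, max (g u) 0 = ∫ u in s..tstar, (0 : ℝ) := by
    apply integral_congr_ae
    refine Filter.Eventually.of_forall fun u hu => ?_
    rw [Set.uIoc_of_le hst] at hu
    exact max_eq_right (hneg u hu.1 hu.2)
  have e2 : ∫ u in tstar..b, max (g u) 0 = ∫ u in tstar..b, g u := by
    apply integral_congr_ae
    refine Filter.Eventually.of_forall fun u hu => ?_
    rw [Set.uIoc_of_le htb] at hu
    exact max_eq_left (hnn u hu.1 hu.2)
  have e3 : ∫ u in tstar..b, g u =
      (μ * b - β⁻¹ * (c - μ) * Real.exp (-β * (b - s))) -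
      (μ * tstar - β⁻¹ * (c - μ) * Real.exp (-β * (tstar - s))) := by
    apply integral_eq_sub_of_hasDerivAt
      (f := fun u => μ * u - β⁻¹ * (c - μ) * Real.exp (-β * (u - s)))
    · intro u _
      have h := (((hasDerivAt_id u).sub_const s).const_mul (-β)).exp
      have h' := ((hasDerivAt_id u).const_mul μ).sub (h.const_mul (β⁻¹ * (c - μ)))
      refine h'.congr_deriv ?_
      rw [hg]
      simp only [id]
      field_simp
      ring
    · exact hcont.intervalIntegrable _ _
  rw [e1, e2, e3]
  simp only [integral_zero]
  ring
end

section
/- Let μ > 0, β > 0, let I be a finite index set with real numbers (t_l)_{l∈I}, (α_l)_{l∈I} satisfying t_l ≤ T for all l ∈ I, let T < T' be real numbers, and define f : ℝ → ℝ by f(t) = μ + Σ_{l∈I} α_l · exp(−β(t − t_l)). Define the restart time T⋆ = min( T + β⁻¹·log((μ − f(T))/μ)·𝟙{f(T) < 0}, T' ). Then for every t ∈ (T, T'): if t ∈ (T⋆, T') then f(t) > 0 and max(f(t), 0) = f(t), while if t ∈ (T, T⋆] then f(t) ≤ 0 and max(f(t), 0) = 0. -/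
open Real Finset

/-- Lemma 1 of the paper on one inter-event interval `(T, T')`: with underlying
intensity `f t = μ + ∑ l, αl l * exp (-β * (t - tl l))` and restart time
`T⋆ = min (T + β⁻¹ * log ((μ - f T) / μ) * 𝟙{f T < 0}) T'`, the intensity is
positive on `(T⋆, T')` (where the conditional intensity equals `f`) and
non-positive on `(T, T⋆]` (where the conditional intensity vanishes). -/
theorem stmt_8 {ι : Type*} (I : Finset ι) (μ β T T' : ℝ)
    (hμ : 0 < μ) (hβ : 0 < β) (hTT' : T < T')
    (tl αl : ι → ℝ) (htl : ∀ l ∈ I, tl l ≤ T)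
    (f : ℝ → ℝ)
    (hf : ∀ t : ℝ, f t = μ + ∑ l ∈ I, αl l * Real.exp (-β * (t - tl l)))
    (Tstar : ℝ)
    (hTstar : Tstar =
      min (T + β⁻¹ * Real.log ((μ - f T) / μ) * (if f T < 0 then (1 : ℝ) else 0)) T') :
    ∀ t : ℝ, T < t → t < T' →
      (Tstar < t → 0 < f t ∧ max (f t) 0 = f t) ∧
      (t ≤ Tstar → f t ≤ 0 ∧ max (f t) 0 = 0) := by
  intro t ht ht'
  have key : f t = μ + (f T - μ) * Real.exp (-β * (t - T)) := by
    rw [hf t, hf T, add_sub_cancel_left, Finset.sum_mul]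
    congr 1
    refine Finset.sum_congr rfl fun l _ => ?_
    rw [mul_assoc, ← Real.exp_add]
    congr 2
    ring
  have he : 0 < Real.exp (-β * (t - T)) := Real.exp_pos _
  have he1 : Real.exp (-β * (t - T)) < 1 := by
    rw [Real.exp_lt_one_iff]
    nlinarith [mul_pos hβ (sub_pos.2 ht)]
  suffices h : (Tstar < t → 0 < f t) ∧ (t ≤ Tstar → f t ≤ 0) from
    ⟨fun h1 => ⟨h.1 h1, max_eq_left (h.1 h1).le⟩, fun h1 => ⟨h.2 h1, max_eq_right (h.2 h1)⟩⟩
  by_cases h0 : f T < 0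
  · rw [if_pos h0, mul_one] at hTstar
    have hr : 0 < (μ - f T) / μ := div_pos (by linarith) hμ
    have hinv : Real.exp (β * (t - T)) * Real.exp (-β * (t - T)) = 1 := by
      rw [← Real.exp_add]
      simp
    have hβi : β * (β⁻¹ * Real.log ((μ - f T) / μ)) = Real.log ((μ - f T) / μ) :=
      mul_inv_cancel_left₀ hβ.ne' _
    constructor
    · intro h1
      rw [hTstar, min_lt_iff] at h1
      have h2 : T + β⁻¹ * Real.log ((μ - f T) / μ) < t := h1.resolve_right (not_lt.2 ht'.le)
      have h3 : Real.log ((μ - f T) / μ) < β * (t - T) := by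
        rw [← hβi]
        exact mul_lt_mul_of_pos_left (by linarith) hβ
      rw [Real.log_lt_iff_lt_exp hr, div_lt_iff₀ hμ] at h3
      have h4 := mul_lt_mul_of_pos_right h3 he
      rw [key]
      linear_combination h4 + μ * hinv
    · intro h1
      rw [hTstar, le_min_iff] at h1
      have h3 : β * (t - T) ≤ Real.log ((μ - f T) / μ) := by
        rw [← hβi]
        exact mul_le_mul_of_nonneg_left (by linarith [h1.1]) hβ.le
      rw [Real.le_log_iff_exp_le hr, le_div_iff₀ hμ] at h3
      have h4 := mul_le_mul_of_nonneg_right h3 he.le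
      rw [key]
      linear_combination h4 - μ * hinv
  · rw [if_neg h0, mul_zero, add_zero, min_eq_left hTT'.le] at hTstar
    have hp : 0 < f t := by
      rw [key]
      nlinarith [mul_pos hμ (sub_pos.2 he1), mul_nonneg (not_lt.1 h0) he.le]
    exact ⟨fun _ => hp, fun h1 => absurd ht (by rw [← hTstar]; exact not_lt.2 h1)⟩
end

section
/- Let β > 0, β' > 0, a ≠ 0, and a', μ, μ' ∈ ℝ, and let s < b be real numbers. If μ + a·exp(−β t) = μ' + a'·exp(−β' t) for every t ∈ (s, b), then μ = μ', β = β' and a = a'. -/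
open Real Set

lemma stmt_10_aux (β β' a a' μ μ' s b : ℝ)
    (h : ∀ t ∈ Set.Ioo s b,
      μ + a * Real.exp (-β * t) = μ' + a' * Real.exp (-β' * t)) :
    ∀ t ∈ Set.Ioo s b,
      0 + (a * -β) * Real.exp (-β * t) = 0 + (a' * -β') * Real.exp (-β' * t) := by
  intro t ht
  have key : ∀ m c k : ℝ, HasDerivAt (fun x : ℝ => m + c * Real.exp (-k * x))
      (c * (Real.exp (-k * t) * (-k * 1))) t := fun m c k =>
    ((((hasDerivAt_id t).const_mul (-k)).exp).const_mul c).const_add m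
  have h1 := key μ a β
  have h2 := key μ' a' β'
  have he : (fun x : ℝ => μ + a * Real.exp (-β * x)) =ᶠ[nhds t]
      (fun x : ℝ => μ' + a' * Real.exp (-β' * x)) := by
    filter_upwards [isOpen_Ioo.mem_nhds ht] with x hx using h x hx
  have h3 := h1.unique (h2.congr_of_eventuallyEq he)
  linarith

/-- Parameter identification for shifted exponentials: if
`μ + a * exp (-β * t) = μ' + a' * exp (-β' * t)` on a non-degenerate interval
`(s, b)` with `a ≠ 0`, then the baselines, decay rates and coefficients
coincide. -/
theorem stmt_10 (β β' a a' μ μ' s b : ℝ)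
    (hβ : 0 < β) (hβ' : 0 < β') (ha : a ≠ 0) (hsb : s < b)
    (h : ∀ t ∈ Set.Ioo s b,
      μ + a * Real.exp (-β * t) = μ' + a' * Real.exp (-β' * t)) :
    μ = μ' ∧ β = β' ∧ a = a' := by
  obtain ⟨t, ht⟩ := Set.nonempty_Ioo.2 hsb
  have h1 := stmt_10_aux _ _ _ _ _ _ _ _ h
  have h2 := stmt_10_aux _ _ _ _ _ _ _ _ h1 t ht
  have h0 := h t ht
  have h1 := h1 t ht
  have hE := Real.exp_ne_zero (-β * t)
  have hb : β = β' := by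
    have hne : a * β * Real.exp (-β * t) ≠ 0 := mul_ne_zero (mul_ne_zero ha hβ.ne') hE
    apply mul_left_cancel₀ hne
    linear_combination h2 + β' * h1
  subst hb
  have haa : a = a' := by
    apply mul_right_cancel₀ (mul_ne_zero hβ.ne' hE)
    linear_combination -h1
  subst haa
  exact ⟨by linarith, rfl, rfl⟩
end

section
/- Let N ≥ 1, let 0 < T_1 < T_2 < … < T_N be strictly increasing real numbers, let a_1, …, a_N ∈ ℝ, μ > 0 and β > 0, and define λ⋆ : ℝ → ℝ by λ⋆(u) = μ + Σ_{k : T_k ≤ u} a_k · exp(−β(u − T_k)). Let t ≥ 0 and let n(t) = #{k : T_k ≤ t}. For k = 1, …, n(t) set b_k = min(t, T_{k+1}) (with the convention T_{N+1} = +∞, so b_{n(t)} = t when n(t) = N or t < T_{n(t)+1}), and set T_k⋆ = min( T_k + β⁻¹·log((μ − λ⋆(T_k))/μ)·𝟙{λ⋆(T_k) < 0}, b_k ). Then ∫_0^t max(λ⋆(u), 0) du = μ·min(t, T_1) + Σ_{k=1}^{n(t)} [ μ·(b_k − T_k⋆) + β⁻¹·(λ⋆(T_k) − μ)·(exp(−β(T_k⋆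 − T_k)) − exp(−β(b_k − T_k))) ]. -/
open Real Finset intervalIntegral

lemma aux_congr (f g : ℝ → ℝ) (p q : ℝ) (hpq : p ≤ q) (hg : Continuous g)
    (h : ∀ u, p ≤ u → u < q → f u = g u) :
    IntervalIntegrable f MeasureTheory.volume p q ∧ ∫ u in p..q, f u = ∫ u in p..q, g u := by
  have hae : ∀ᵐ u ∂MeasureTheory.volume, u ∈ Set.uIoc p q → g u = f u := by
    have : ∀ᵐ u ∂(MeasureTheory.volume : MeasureTheory.Measure ℝ), u ≠ q := by
      simp [MeasureTheory.ae_iff]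
    filter_upwards [this] with u hu hm
    rw [Set.uIoc_of_le hpq] at hm
    exact (h u hm.1.le (lt_of_le_of_ne hm.2 hu)).symm
  refine ⟨?_, ?_⟩
  · refine (hg.intervalIntegrable p q).congr_ae ?_
    exact (MeasureTheory.ae_restrict_iff' measurableSet_uIoc).2 hae
  · exact (intervalIntegral.integral_congr_ae hae).symm

lemma aux_int (μ β d p q r : ℝ) (hβ : 0 < β) :
    ∫ u in q..r, (μ + d * Real.exp (-β * (u - p))) =
      μ * (r - q) + β⁻¹ * d * (Real.exp (-β * (q - p)) - Real.exp (-β * (r - p))) := by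
  have hd : ∀ x ∈ Set.uIcc q r, HasDerivAt
      (fun u => μ * u - β⁻¹ * d * Real.exp (-β * (u - p)))
      (μ + d * Real.exp (-β * (x - p))) x := by
    intro x _
    have h1 : HasDerivAt (fun u : ℝ => -β * (u - p)) (-β * 1) x :=
      ((hasDerivAt_id x).sub_const p).const_mul (-β)
    have h2 := ((hasDerivAt_id x).const_mul μ).sub (h1.exp.const_mul (β⁻¹ * d))
    refine h2.congr_deriv ?_
    field_simp
    ring
  rw [intervalIntegral.integral_eq_sub_of_hasDerivAt hd
    (Continuous.intervalIntegrable (by fun_prop) _ _)]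
  ring

lemma aux_piece (μ β c p q : ℝ) (hμ : 0 < μ) (hβ : 0 < β) (hpq : p ≤ q) (s : ℝ)
    (hs : s = min (p + β⁻¹ * Real.log ((μ - c) / μ) * (if c < 0 then (1 : ℝ) else 0)) q) :
    ∫ u in p..q, max (μ + (c - μ) * Real.exp (-β * (u - p))) 0 =
      μ * (q - s) + β⁻¹ * (c - μ) *
        (Real.exp (-β * (s - p)) - Real.exp (-β * (q - p))) := by
  have hcont : Continuous (fun u => max (μ + (c - μ) * Real.exp (-β * (u - p))) 0) := by
    fun_prop
  have hsq : s ≤ q := hs ▸ min_le_right _ _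
  have hneg : p ≤ s ∧ ∀ u, p ≤ u → u < s → μ + (c - μ) * Real.exp (-β * (u - p)) ≤ 0 := by
    by_cases hc : c < 0
    · simp only [hc, if_true, mul_one] at hs
      have hpos : 0 < (μ - c) / μ := by apply div_pos <;> linarith
      refine ⟨?_, ?_⟩
      · rw [hs]
        refine le_min ?_ hpq
        have : 0 ≤ Real.log ((μ - c) / μ) :=
          Real.log_nonneg (by rw [le_div_iff₀ hμ]; linarith)
        have := mul_nonneg (inv_pos.2 hβ).le this
        linarith
      · intro u _ hu
        have h1 : u < p + β⁻¹ * Real.log ((μ - c) / μ) :=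
          lt_of_lt_of_le hu (hs ▸ min_le_left _ _)
        have h2 : -Real.log ((μ - c) / μ) ≤ -β * (u - p) := by
          have : β * (u - p) ≤ β * (β⁻¹ * Real.log ((μ - c) / μ)) :=
            mul_le_mul_of_nonneg_left (by linarith) hβ.le
          rw [mul_inv_cancel_left₀ hβ.ne'] at this
          linarith
        have h3 := Real.exp_le_exp.2 h2
        rw [Real.exp_neg, Real.exp_log hpos, inv_div] at h3
        rw [div_le_iff₀ (by linarith)] at h3
        linarith
    · simp only [hc, if_false, mul_zero, add_zero, min_eq_left hpq] at hs
      exact ⟨hs.ge, fun u h1 h2 => by linarith⟩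
  have hge : ∀ u, s ≤ u → u < q → 0 ≤ μ + (c - μ) * Real.exp (-β * (u - p)) := by
    intro u h1 h2
    by_cases hc : c < 0
    · simp only [hc, if_true, mul_one] at hs
      have hpos : 0 < (μ - c) / μ := by apply div_pos <;> linarith
      have h3 : p + β⁻¹ * Real.log ((μ - c) / μ) ≤ u := by
        rcases min_le_iff.1 (hs ▸ h1) with h | h
        · exact h
        · linarith
      have h2 : -β * (u - p) ≤ -Real.log ((μ - c) / μ) := by
        have : β * (β⁻¹ * Real.log ((μ - c) / μ)) ≤ β * (u - p) :=
          mul_le_mul_of_nonneg_left (by linarith) hβ.le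
        rw [mul_inv_cancel_left₀ hβ.ne'] at this
        linarith
      have h3 := Real.exp_le_exp.2 h2
      rw [Real.exp_neg, Real.exp_log hpos, inv_div] at h3
      rw [le_div_iff₀ (by linarith)] at h3
      linarith
    · have hpu := hneg.1.trans h1
      have he : Real.exp (-β * (u - p)) ≤ 1 := by
        rw [Real.exp_le_one_iff]
        nlinarith
      have := Real.exp_pos (-β * (u - p))
      nlinarith
  rw [← intervalIntegral.integral_add_adjacent_intervals
    (hcont.intervalIntegrable p s) (hcont.intervalIntegrable s q)]
  rw [(aux_congr _ (fun _ => 0) p s hneg.1 continuous_const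
    (fun u h1 h2 => max_eq_right (hneg.2 u h1 h2))).2]
  rw [(aux_congr _ (fun u => μ + (c - μ) * Real.exp (-β * (u - p))) s q hsq (by fun_prop)
    (fun u h1 h2 => max_eq_left (hge u h1 h2))).2]
  rw [aux_int _ _ _ _ _ _ hβ]
  simp

/-- Proposition 1 of the paper (compensator for multivariate exponential
kernels), stated deterministically for one coordinate: the integral of the
conditional intensity `max (λ⋆ u) 0` over `[0, t]` equals
`μ * min t (T 1)` plus the sum over the inter-event intervals of the
closed-form contributions `J_k` expressed with the restart times `T_k⋆`. -/
theorem stmt_13 (N : ℕ) (hN : 1 ≤ N)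
    (T : ℕ → ℝ) (hT1 : 0 < T 1)
    (hTmono : ∀ k : ℕ, 1 ≤ k → k + 1 ≤ N → T k < T (k + 1))
    (a : ℕ → ℝ) (μ β t : ℝ) (hμ : 0 < μ) (hβ : 0 < β) (ht : 0 ≤ t)
    (lamStar : ℝ → ℝ)
    (hlam : ∀ u : ℝ, lamStar u =
      μ + ∑ k ∈ Finset.Icc 1 N,
        if T k ≤ u then a k * Real.exp (-β * (u - T k)) else 0)
    (n : ℕ) (hn : n = ((Finset.Icc 1 N).filter (fun k => T k ≤ t)).card)
    (b : ℕ → ℝ) (hb : ∀ k : ℕ, b k = if k < N then min t (T (k + 1)) else t)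
    (Tstar : ℕ → ℝ)
    (hTstar : ∀ k : ℕ, Tstar k =
      min (T k + β⁻¹ * Real.log ((μ - lamStar (T k)) / μ) *
            (if lamStar (T k) < 0 then (1 : ℝ) else 0)) (b k)) :
    ∫ u in (0 : ℝ)..t, max (lamStar u) 0 =
      μ * min t (T 1) +
        ∑ k ∈ Finset.Icc 1 n,
          (μ * (b k - Tstar k) +
            β⁻¹ * (lamStar (T k) - μ) *
              (Real.exp (-β * (Tstar k - T k)) - Real.exp (-β * (b k - T k)))) := by
  have hmono : ∀ i j : ℕ, 1 ≤ i → i ≤ j → j ≤ N → T i ≤ T j := by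
    intro i j hi hij
    induction j, hij using Nat.le_induction with
    | base => intro _; exact le_rfl
    | succ j hij ih =>
      intro hj
      exact (ih (by omega)).trans (hTmono j (by omega) hj).le
  have hnN : n ≤ N := by
    rw [hn]
    exact (Finset.card_filter_le _ _).trans (by simp)
  have hle : ∀ k, 1 ≤ k → k ≤ n → T k ≤ t := by
    intro k hk hkn
    by_contra hlt
    have hsub : (Finset.Icc 1 N).filter (fun k => T k ≤ t) ⊆ Finset.Icc 1 (k - 1) := by
      intro j hj
      simp only [Finset.mem_filter, Finset.mem_Icc] at hj ⊢
      refine ⟨hj.1.1, ?_⟩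
      by_contra hjk
      exact hlt ((hmono k j hk (by omega) hj.1.2).trans hj.2)
    have := Finset.card_le_card hsub
    rw [← hn] at this
    simp at this
    omega
  have hgt : ∀ k, n < k → k ≤ N → t < T k := by
    intro k hk hkN
    by_contra hlt
    have hsub : Finset.Icc 1 k ⊆ (Finset.Icc 1 N).filter (fun k => T k ≤ t) := by
      intro j hj
      simp only [Finset.mem_filter, Finset.mem_Icc] at hj ⊢
      exact ⟨⟨hj.1, hj.2.trans hkN⟩, (hmono j k hj.1 hj.2 hkN).trans (not_lt.1 hlt)⟩
    have := Finset.card_le_card hsub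
    rw [← hn] at this
    simp at this
    omega
  have hb1 : ∀ k, 1 ≤ k → k < n → b k = T (k + 1) := by
    intro k hk hkn
    rw [hb, if_pos (by omega), min_eq_right (hle _ (by omega) (by omega))]
  have hb2 : b n = t := by
    rw [hb]
    split_ifs with h
    · exact min_eq_left (hgt _ (by omega) (by omega)).le
    · rfl
  have hTb : ∀ k, 1 ≤ k → k ≤ n → T k ≤ b k := by
    intro k hk hkn
    rw [hb]
    split_ifs with h
    · exact le_min (hle k hk hkn) (hTmono k hk (by omega)).le
    · exact hle k hk hkn
  have hpiece : ∀ k, 1 ≤ k → k ≤ n → ∀ u, T k ≤ u → u < b k →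
      lamStar u = μ + (lamStar (T k) - μ) * Real.exp (-β * (u - T k)) := by
    intro k hk hkn u hu1 hu2
    rw [hlam u, hlam (T k), add_sub_cancel_left, Finset.sum_mul]
    congr 1
    refine Finset.sum_congr rfl fun j hj => ?_
    rw [Finset.mem_Icc] at hj
    by_cases hjk : j ≤ k
    · have h1 := hmono j k hj.1 hjk (by omega)
      rw [if_pos (h1.trans hu1), if_pos h1, mul_assoc, ← Real.exp_add]
      ring_nf
    · have h1 : T (k + 1) ≤ T j := hmono (k + 1) j (by omega) (by omega) hj.2
      have h2 := hTmono k hk (by omega)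
      have h3 : b k ≤ T (k + 1) := by
        rw [hb, if_pos (by omega)]
        exact min_le_right _ _
      rw [if_neg (by linarith), if_neg (by linarith), zero_mul]
  have hint : ∀ k, 1 ≤ k → k ≤ n →
      IntervalIntegrable (fun u => max (lamStar u) 0) MeasureTheory.volume (T k) (b k) ∧
      ∫ u in (T k)..(b k), max (lamStar u) 0 = μ * (b k - Tstar k) +
            β⁻¹ * (lamStar (T k) - μ) *
              (Real.exp (-β * (Tstar k - T k)) - Real.exp (-β * (b k - T k))) := by
    intro k hk hkn
    have h := aux_congr (fun u => max (lamStar u) 0)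
      (fun u => max (μ + (lamStar (T k) - μ) * Real.exp (-β * (u - T k))) 0)
      (T k) (b k) (hTb k hk hkn) (by fun_prop)
      (fun u h1 h2 => by simp only [← hpiece k hk hkn u h1 h2])
    exact ⟨h.1, h.2.trans (aux_piece μ β _ _ _ hμ hβ (hTb k hk hkn) _ (hTstar k))⟩
  have hzero : ∀ s, 0 ≤ s → s ≤ T 1 →
      IntervalIntegrable (fun u => max (lamStar u) 0) MeasureTheory.volume 0 s ∧
      ∫ u in (0 : ℝ)..s, max (lamStar u) 0 = μ * s := by
    intro s hs0 hs
    have h := aux_congr (fun u => max (lamStar u) 0) (fun _ => μ) 0 s hs0 continuous_const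
      (fun u h1 h2 => by
        have : lamStar u = μ := by
          rw [hlam, Finset.sum_eq_zero, add_zero]
          intro j hj
          rw [Finset.mem_Icc] at hj
          have := hmono 1 j le_rfl hj.1 hj.2
          rw [if_neg (by linarith)]
        simp only [this]
        exact max_eq_left hμ.le)
    refine ⟨h.1, h.2.trans ?_⟩
    simp [mul_comm]
  have hind : ∀ m, m + 1 ≤ n →
      IntervalIntegrable (fun u => max (lamStar u) 0) MeasureTheory.volume 0 (T (m + 1)) ∧
      ∫ u in (0 : ℝ)..(T (m + 1)), max (lamStar u) 0 = μ * T 1 +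
        ∑ k ∈ Finset.Icc 1 m,
          (μ * (b k - Tstar k) +
            β⁻¹ * (lamStar (T k) - μ) *
              (Real.exp (-β * (Tstar k - T k)) - Real.exp (-β * (b k - T k)))) := by
    intro m
    induction m with
    | zero =>
      intro _
      simpa using hzero (T 1) hT1.le le_rfl
    | succ m ih =>
      intro hm
      have h1 := ih (by omega)
      have h2 := hint (m + 1) (by omega) (by omega)
      have hbb := hb1 (m + 1) (by omega) (by omega)
      rw [Finset.sum_Icc_succ_top (by omega), ← add_assoc, ← h1.2, ← h2.2, hbb]
      rw [hbb] at h2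
      exact ⟨h1.1.trans h2.1,
        (intervalIntegral.integral_add_adjacent_intervals h1.1 h2.1).symm⟩
  rcases Nat.eq_zero_or_pos n with h0 | h0
  · have := (hgt 1 (by omega) hN).le
    rw [(hzero t ht this).2, min_eq_left this, h0]
    simp
  · obtain ⟨m, hm⟩ : ∃ m, n = m + 1 := ⟨n - 1, by omega⟩
    have h1 := hind m (by omega)
    have h2 := hint (m + 1) (by omega) (by omega)
    rw [min_eq_right (hle 1 le_rfl h0), hm, Finset.sum_Icc_succ_top (by omega), ← add_assoc,
      ← h1.2, ← h2.2]
    rw [hm] at hb2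
    rw [hb2] at h2 ⊢
    exact (intervalIntegral.integral_add_adjacent_intervals h1.1 h2.1).symm
end

section
/- Fix integers d ≥ 1 and n ≥ 1, strictly increasing times 0 < T_1 < … < T_n and marks m_1, …, m_n ∈ {1, …, d}, and an index i ∈ {1, …, d}. For parameters θ = (μ, β, α) with μ > 0, β > 0 and α : {1, …, d} → ℝ, define λ⋆_θ(t) = μ + Σ_{k : T_k ≤ t} α(m_k)·exp(−β(t − T_k)) and λ_θ(t) = max(λ⋆_θ(t), 0). Let θ = (μ, β, α) and θ' = (μ', β', α') both satisfy μ, μ' > 0 and β, β' > 0, and assume λ_θ(t) = λ_{θ'}(t) for every t ≥ 0. Assume moreover: (a) at least two of the marks m_1, …, m_n equal i, and at every event time T_k with m_k = i the left limit of λ⋆_θ at T_k is strictly positive; (b) there exists an index K with m_K = i such that λ⋆_θ(T_{K−1}) ≠ μ (where T_{K−1} is the event time preceding T_K, or λ⋆_θ is not identically μ on (0, T_K) if K = 1); (c) for every j ∈ {1, …, d} with j ≠ i there exist indices p < q such that m_p = j, m_q = i, the left limit of λ⋆_θ at T_p is strictly positive, and m_r = j for every r with p ≤ r < q. Then μ =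 μ', β = β' and α(j) = α'(j) for every j ∈ {1, …, d}. -/
open Real Finset Filter Topology

/-- Underlying intensity of coordinate `i` of a multivariate exponential Hawkes
process with common decay rate: baseline `μ`, decay rate `β`, interaction
weights `α j` of subprocess `j`, event times `T 1 < … < T n` with marks `m k`. -/
noncomputable def hawkesUnderlying (n : ℕ) (T : ℕ → ℝ) {d : ℕ} (m : ℕ → Fin d)
    (μ β : ℝ) (α : Fin d → ℝ) (t : ℝ) : ℝ :=
  μ + ∑ k ∈ Finset.Icc 1 n,
    if T k ≤ t then α (m k) * Real.exp (-β * (t - T k)) else 0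

lemma hk_mono (n : ℕ) (T : ℕ → ℝ)
    (hTmono : ∀ k : ℕ, 1 ≤ k → k + 1 ≤ n → T k < T (k + 1)) (a b : ℕ) (ha : 1 ≤ a)
    (hab : a < b) (hb : b ≤ n) : T a < T b := by
  induction b, hab using Nat.le_induction with
  | base => exact hTmono a ha hb
  | succ b hab ih => exact (ih (by omega)).trans (hTmono b (by omega) hb)

lemma hk_formula (n : ℕ) (T : ℕ → ℝ)
    (hTmono : ∀ k : ℕ, 1 ≤ k → k + 1 ≤ n → T k < T (k + 1)) {d : ℕ} (m : ℕ → Fin d)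
    (μ β : ℝ) (α : Fin d → ℝ) (k : ℕ) (hk : 1 ≤ k) (hkn : k ≤ n) (t : ℝ) (ht : t < T k)
    (hr : ∀ r ∈ Finset.Ico 1 k, T r ≤ t) :
    hawkesUnderlying n T m μ β α t =
      μ + (∑ r ∈ Finset.Ico 1 k, α (m r) * Real.exp (β * T r)) * Real.exp (-β * t) := by
  unfold hawkesUnderlying
  congr 1
  rw [Finset.sum_mul]
  have hsub : Finset.Ico 1 k ⊆ Finset.Icc 1 n := by
    intro r h
    simp only [Finset.mem_Ico, Finset.mem_Icc] at *
    omega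
  rw [← Finset.sum_subset hsub]
  · apply Finset.sum_congr rfl
    intro r h
    rw [if_pos (hr r h), mul_assoc, ← Real.exp_add]
    ring_nf
  · intro r h1 h2
    simp only [Finset.mem_Ico, Finset.mem_Icc] at *
    rw [if_neg]
    rw [not_le]
    rcases eq_or_lt_of_le (show k ≤ r by omega) with h | h
    · rwa [← h]
    · exact ht.trans (hk_mono n T hTmono k r hk h h1.2)

lemma hk_ev (n : ℕ) (T : ℕ → ℝ)
    (hTmono : ∀ k : ℕ, 1 ≤ k → k + 1 ≤ n → T k < T (k + 1)) {d : ℕ} (m : ℕ → Fin d)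
    (μ β : ℝ) (α : Fin d → ℝ) (k : ℕ) (hk : 1 ≤ k) (hkn : k ≤ n) :
    ∀ᶠ t in 𝓝[<] (T k), hawkesUnderlying n T m μ β α t =
      μ + (∑ r ∈ Finset.Ico 1 k, α (m r) * Real.exp (β * T r)) * Real.exp (-β * t) := by
  have h1 : ∀ᶠ t in 𝓝[<] (T k), ∀ r ∈ Finset.Ico 1 k, T r ≤ t := by
    rw [Filter.eventually_all_finset]
    intro r hr
    rw [Finset.mem_Ico] at hr
    have := hk_mono n T hTmono r k hr.1 hr.2 hkn
    exact (nhdsWithin_le_nhds (eventually_ge_nhds this))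
  filter_upwards [h1, self_mem_nhdsWithin] with t ht1 ht2
  exact hk_formula n T hTmono m μ β α k hk hkn t ht2 ht1

lemma hk_tendsto (n : ℕ) (T : ℕ → ℝ)
    (hTmono : ∀ k : ℕ, 1 ≤ k → k + 1 ≤ n → T k < T (k + 1)) {d : ℕ} (m : ℕ → Fin d)
    (μ β : ℝ) (α : Fin d → ℝ) (k : ℕ) (hk : 1 ≤ k) (hkn : k ≤ n) :
    Tendsto (hawkesUnderlying n T m μ β α) (𝓝[<] (T k))
      (𝓝 (μ + (∑ r ∈ Finset.Ico 1 k, α (m r) * Real.exp (β * T r)) * Real.exp (-β * T k))) := by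
  refine Tendsto.congr' (EventuallyEq.symm (hk_ev n T hTmono m μ β α k hk hkn)) ?_
  refine Tendsto.mono_left (Continuous.tendsto ?_ _) nhdsWithin_le_nhds
  fun_prop

/-- Deterministic formulation of Theorem 1 (identifiability) of the paper for
one coordinate `i`: if the conditional intensities `max (λ⋆_θ) 0` and
`max (λ⋆_θ') 0` coincide on `[0, ∞)` and the observability assumptions
(a), (b), (c) hold, then the two parameter sets coincide. -/
theorem stmt_15 (d n : ℕ) (hd : 1 ≤ d) (hn : 1 ≤ n)
    (T : ℕ → ℝ) (hT1 : 0 < T 1)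
    (hTmono : ∀ k : ℕ, 1 ≤ k → k + 1 ≤ n → T k < T (k + 1))
    (m : ℕ → Fin d) (i : Fin d)
    (μ μ' β β' : ℝ) (α α' : Fin d → ℝ)
    (hμ : 0 < μ) (hμ' : 0 < μ') (hβ : 0 < β) (hβ' : 0 < β')
    (heq : ∀ t : ℝ, 0 ≤ t →
      max (hawkesUnderlying n T m μ β α t) 0 =
        max (hawkesUnderlying n T m μ' β' α' t) 0)
    -- (a) at least two events of coordinate `i`, and the left limit of the
    -- underlying intensity is positive at each event time of coordinate `i`
    (ha1 : ∃ p ∈ Finset.Icc 1 n, ∃ q ∈ Finset.Icc 1 n,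
      p ≠ q ∧ m p = i ∧ m q = i)
    (ha2 : ∀ k ∈ Finset.Icc 1 n, m k = i →
      0 < Function.leftLim (hawkesUnderlying n T m μ β α) (T k))
    -- (b) some event of coordinate `i` is not preceded by an intensity equal
    -- to the baseline
    (hb : ∃ K ∈ Finset.Icc 1 n, m K = i ∧
      (2 ≤ K → hawkesUnderlying n T m μ β α (T (K - 1)) ≠ μ) ∧
      (K = 1 → ¬ ∀ t ∈ Set.Ioo (0 : ℝ) (T K),
        hawkesUnderlying n T m μ β α t = μ))
    -- (c) for every `j ≠ i`, an event of `j` with positive pre-event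
    -- intensity is followed, after only events of `j`, by an event of `i`
    (hc : ∀ j : Fin d, j ≠ i →
      ∃ p ∈ Finset.Icc 1 n, ∃ q ∈ Finset.Icc 1 n,
        p < q ∧ m p = j ∧ m q = i ∧
        0 < Function.leftLim (hawkesUnderlying n T m μ β α) (T p) ∧
        ∀ r : ℕ, p ≤ r → r < q → m r = j) :
    μ = μ' ∧ β = β' ∧ ∀ j : Fin d, α j = α' j := by
  have hpos : ∀ k, 1 ≤ k → k ≤ n → 0 < T k := by
    intro k h1 h2
    rcases eq_or_lt_of_le h1 with h | h
    · rwa [← h]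
    · exact hT1.trans (hk_mono n T hTmono 1 k le_rfl h h2)
  have hμe : μ = μ' := by
    have h := heq 0 le_rfl
    have e1 := hk_formula n T hTmono m μ β α 1 le_rfl hn 0 hT1 (by simp)
    have e2 := hk_formula n T hTmono m μ' β' α' 1 le_rfl hn 0 hT1 (by simp)
    simp only [Finset.Ico_self, Finset.sum_empty, zero_mul, add_zero] at e1 e2
    rwa [e1, e2, max_eq_left hμ.le, max_eq_left hμ'.le] at h
  subst hμe
  -- eventual equality to the left of events with positive left limit
  have hev : ∀ k, 1 ≤ k → k ≤ n →
      0 < Function.leftLim (hawkesUnderlying n T m μ β α) (T k) →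
      ∀ᶠ t in 𝓝[<] (T k),
        (∑ r ∈ Finset.Ico 1 k, α (m r) * Real.exp (β * T r)) * Real.exp (-β * t) =
        (∑ r ∈ Finset.Ico 1 k, α' (m r) * Real.exp (β' * T r)) * Real.exp (-β' * t) := by
    intro k h1 h2 hL
    have ht := hk_tendsto n T hTmono m μ β α k h1 h2
    rw [leftLim_eq_of_tendsto ht] at hL
    have hp := ht.eventually (eventually_gt_nhds hL)
    have h0 : ∀ᶠ t in 𝓝[<] (T k), 0 ≤ t :=
      nhdsWithin_le_nhds (eventually_ge_nhds (hpos k h1 h2))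
    filter_upwards [hp, h0, hk_ev n T hTmono m μ β α k h1 h2,
      hk_ev n T hTmono m μ β' α' k h1 h2] with t a0 a1 a2 a3
    have h := heq t a1
    rw [max_eq_left a0.le] at h
    have hp' : 0 < hawkesUnderlying n T m μ β' α' t := by
      by_contra hcon
      rw [max_eq_right (not_lt.mp hcon)] at h
      linarith
    rw [max_eq_left hp'.le, a2, a3] at h
    linarith
  have hβe : β = β' := by
    obtain ⟨K, hK, hKi, hb2, hb1⟩ := hb
    have hL := ha2 K hK hKi
    rw [Finset.mem_Icc] at hK
    rcases eq_or_lt_of_le hK.1 with h | h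
    · exfalso
      subst h
      refine hb1 rfl ?_
      intro t ht
      have e1 := hk_formula n T hTmono m μ β α 1 le_rfl hn t ht.2 (by simp)
      simpa using e1
    have hne := hb2 h
    have e1 := hk_formula n T hTmono m μ β α K hK.1 hK.2 (T (K - 1))
      (hk_mono n T hTmono _ _ (by omega) (by omega) hK.2) (by
        intro r hr
        rw [Finset.mem_Ico] at hr
        rcases eq_or_lt_of_le (show r ≤ K - 1 by omega) with h' | h'
        · rw [h']
        · exact (hk_mono n T hTmono _ _ hr.1 h' (by omega)).le)
    have hE := hev K hK.1 hK.2 hL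
    generalize (∑ r ∈ Finset.Ico 1 K, α (m r) * Real.exp (β * T r)) = A at e1 hE
    generalize (∑ r ∈ Finset.Ico 1 K, α' (m r) * Real.exp (β' * T r)) = B at hE
    have hA : A ≠ 0 := by
      rintro rfl
      apply hne
      rw [e1]
      ring
    obtain ⟨a, ha, hsub⟩ := (mem_nhdsLT_iff_exists_Ioo_subset).1 hE
    have ha' : a < T K := ha
    obtain ⟨t1, h1a, h1b⟩ := exists_between ha'
    obtain ⟨t2, h2a, h2b⟩ := exists_between h1b
    have q1 : A * Real.exp (-β * t1) = B * Real.exp (-β' * t1) := hsub ⟨h1a, h1b⟩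
    have q2 : A * Real.exp (-β * t2) = B * Real.exp (-β' * t2) := hsub ⟨h1a.trans h2a, h2b⟩
    have hB : B ≠ 0 := by
      rintro rfl
      rw [zero_mul] at q1
      exact (mul_ne_zero hA (Real.exp_ne_zero _)) q1
    have q3 : (A * B) * Real.exp (-β * t1 + -β' * t2) =
        (A * B) * Real.exp (-β * t2 + -β' * t1) := by
      rw [Real.exp_add, Real.exp_add]
      linear_combination B * Real.exp (-β' * t2) * q1 - B * Real.exp (-β' * t1) * q2
    have q4 := Real.exp_injective (mul_left_cancel₀ (mul_ne_zero hA hB) q3)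
    have q5 : (β - β') * (t2 - t1) = 0 := by linarith
    rcases mul_eq_zero.1 q5 with h | h <;> linarith
  subst hβe
  have hS : ∀ k, 1 ≤ k → k ≤ n →
      0 < Function.leftLim (hawkesUnderlying n T m μ β α) (T k) →
      ∑ r ∈ Finset.Ico 1 k, (α (m r) - α' (m r)) * Real.exp (β * T r) = 0 := by
    intro k h1 h2 hL
    obtain ⟨t, ht⟩ := (hev k h1 h2 hL).exists
    have := mul_right_cancel₀ (Real.exp_ne_zero _) ht
    simp only [sub_mul, Finset.sum_sub_distrib]
    linarith
  have hD : ∀ p q, 1 ≤ p → p < q → q ≤ n →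
      0 < Function.leftLim (hawkesUnderlying n T m μ β α) (T p) →
      0 < Function.leftLim (hawkesUnderlying n T m μ β α) (T q) →
      ∑ r ∈ Finset.Ico p q, (α (m r) - α' (m r)) * Real.exp (β * T r) = 0 := by
    intro p q h1 h2 h3 hp hq
    have e1 := hS p h1 (by omega) hp
    have e2 := hS q (by omega) h3 hq
    rw [← Finset.sum_Ico_consecutive _ h1 h2.le, e1, zero_add] at e2
    exact e2
  -- a window on which all differences with mark other than `j` vanish identifies `j`
  have hfin : ∀ j p q, 1 ≤ p → p < q → q ≤ n → m p = j →
      0 < Function.leftLim (hawkesUnderlying n T m μ β α) (T p) →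
      0 < Function.leftLim (hawkesUnderlying n T m μ β α) (T q) →
      (∀ r, p ≤ r → r < q → m r ≠ j → α (m r) = α' (m r)) → α j = α' j := by
    intro j p q h1 h2 h3 hj hp hq hr
    have e := hD p q h1 h2 h3 hp hq
    have e2 : ∑ r ∈ Finset.Ico p q, (α (m r) - α' (m r)) * Real.exp (β * T r) =
        (α j - α' j) * ∑ r ∈ Finset.Ico p q, if m r = j then Real.exp (β * T r) else 0 := by
      rw [Finset.mul_sum]
      apply Finset.sum_congr rfl
      intro r hrm
      rw [Finset.mem_Ico] at hrm
      by_cases h : m r = j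
      · rw [if_pos h, h]
      · rw [if_neg h, hr r hrm.1 hrm.2 h]
        ring
    have hpos2 : 0 < ∑ r ∈ Finset.Ico p q, if m r = j then Real.exp (β * T r) else 0 := by
      apply Finset.sum_pos'
      · intro r _
        split_ifs
        · positivity
        · exact le_rfl
      · refine ⟨p, by simp [h2], ?_⟩
        rw [if_pos hj]
        positivity
    rw [e2] at e
    rcases mul_eq_zero.1 e with h | h <;> linarith
  have hne : ∀ j, j ≠ i → α j = α' j := by
    intro j hj
    obtain ⟨p, hp, q, hq, hpq, hpj, hqi, hL, hr⟩ := hc j hj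
    have hLq := ha2 q hq hqi
    rw [Finset.mem_Icc] at hp hq
    exact hfin j p q hp.1 hpq hq.2 hpj hL hLq (fun r a b c => absurd (hr r a b) c)
  refine ⟨rfl, rfl, ?_⟩
  intro j
  by_cases hj : j = i
  · subst hj
    obtain ⟨p, hp, q, hq, hpq, hpi, hqi⟩ := ha1
    have hLp := ha2 p hp hpi
    have hLq := ha2 q hq hqi
    rw [Finset.mem_Icc] at hp hq
    rcases lt_or_gt_of_ne hpq with h | h
    · exact hfin j p q hp.1 h hq.2 hpi hLp hLq (fun r _ _ c => hne _ c)
    · exact hfin j q p hq.1 h hp.2 hqi hLq hLp (fun r _ _ c => hne _ c)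
  · exact hne j hj
end
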